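/- Let n ≥ 1, κ > 0, let μ0, μ1 be finite nonnegative compactly supported Borel measures on ℝ^n, and let π be a minimizer of E_κ(·|μ0,μ1), with marginals π0, π1 and Lebesgue decompositions μ0 = (dμ0/dπ0)π0 + μ0^⊥, μ1 = (dμ1/dπ1)π1 + μ1^⊥. Define the semi-couplings γ0 = (dμ0/dπ0)·π + (id,id)_# μ0^⊥ and γ1 = (dμ1/dπ1)·π + (id,id)_# μ1^⊥. Then proj_{i#} γ_i = μ_i for i = 0,1, and κ²( γ0(ℝ^n×ℝ^n) + γ1(ℝ^n×ℝ^n) − 2 ∫ Cos(|x−y|/κ) d√(γ0γ1)(x,y) ) = HK_κ²(μ0,μ1), where Cos(s) = cos(min(|s|, π/2)). -/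

import Mathlib

open MeasureTheory ENNReal Filter Topology RealInnerProductSpace
open scoped Classical

noncomputable section

abbrev Eucl (n : ℕ) : Type := EuclideanSpace ℝ (Fin n)

/-- Truncated cosine `Cos`. -/
def truncCos (s : ℝ) : ℝ := Real.cos (min |s| (Real.pi / 2))

/-- The Hellinger–Kantorovich cost function `c_κ`. -/
def cHK {n : ℕ} (κ : ℝ) (x y : Eucl n) : ℝ≥0∞ :=
  if dist x y < κ * Real.pi / 2 then
    ENNReal.ofReal (-2 * κ ^ 2 * Real.log (Real.cos (dist x y / κ)))
  else ⊤

/-- Kullback–Leibler divergence `KL(ρ|μ)`. -/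
def KLdiv {α : Type*} [MeasurableSpace α] (ρ μ : Measure α) : ℝ≥0∞ :=
  if ρ ≪ μ then
    ∫⁻ x, ENNReal.ofReal ((ρ.rnDeriv μ x).toReal * Real.log (ρ.rnDeriv μ x).toReal
      - (ρ.rnDeriv μ x).toReal + 1) ∂μ
  else ⊤

/-- The soft-marginal Hellinger–Kantorovich functional `E_κ(π|μ0,μ1)`. -/
def HKfun {n : ℕ} (κ : ℝ) (π : Measure (Eucl n × Eucl n)) (μ0 μ1 : Measure (Eucl n)) : ℝ≥0∞ :=
  ∫⁻ p, cHK κ p.1 p.2 ∂π + ENNReal.ofReal (κ ^ 2) * KLdiv (π.map Prod.fst) μ0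
    + ENNReal.ofReal (κ ^ 2) * KLdiv (π.map Prod.snd) μ1

/-- The squared Hellinger–Kantorovich distance `HK_κ²(μ0,μ1)`. -/
def HK2 {n : ℕ} (κ : ℝ) (μ0 μ1 : Measure (Eucl n)) : ℝ≥0∞ :=
  ⨅ (π : Measure (Eucl n × Eucl n)) (_ : IsFiniteMeasure π), HKfun κ π μ0 μ1

/-- The squared 2-Wasserstein distance `W2²(μ0,μ1)`. -/
def W2sq {n : ℕ} (μ0 μ1 : Measure (Eucl n)) : ℝ≥0∞ :=
  ⨅ (π : Measure (Eucl n × Eucl n))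
    (_ : π.map Prod.fst = μ0 ∧ π.map Prod.snd = μ1),
      ∫⁻ p, ENNReal.ofReal (dist p.1 p.2 ^ 2) ∂π

/-- Narrow convergence of a sequence of measures. -/
def NarrowTendsto {α : Type*} [MeasurableSpace α] [TopologicalSpace α]
    (ρ : ℕ → Measure α) (ρlim : Measure α) : Prop :=
  ∀ φ : BoundedContinuousFunction α ℝ,
    Tendsto (fun N => ∫ x, φ x ∂(ρ N)) atTop (𝓝 (∫ x, φ x ∂ρlim))

/-- The spherical Hellinger–Kantorovich distance `SHK_κ(μ0,μ1)`. -/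
def SHK {n : ℕ} (κ : ℝ) (μ0 μ1 : Measure (Eucl n)) : ℝ :=
  κ * Real.arccos (1 - (HK2 κ μ0 μ1).toReal / (2 * κ ^ 2))

/-- The square-root measure `√(ρσ)`. -/
def sqrtMeasure {α : Type*} [MeasurableSpace α] (ρ σ : Measure α) : Measure α :=
  (ρ + σ).withDensity (fun x => (ρ.rnDeriv (ρ + σ) x * σ.rnDeriv (ρ + σ) x) ^ (1/2 : ℝ))



/-- barycentric HK velocity. -/
def barV {n : ℕ} (κ : ℝ) (μ0 : Measure (Eucl n)) (π : Measure (Eucl n × Eucl n))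
    [IsFiniteMeasure π] (x : Eucl n) : Eucl n :=
  (κ * ((π.map Prod.fst).rnDeriv μ0 x).toReal) •
    ∫ y, (Real.tan (‖y - x‖ / κ) / ‖y - x‖) • (y - x) ∂(π.condKernel x)

/-- barycentric HK growth. -/
def barA {n : ℕ} (μ0 : Measure (Eucl n)) (π : Measure (Eucl n × Eucl n)) (x : Eucl n) : ℝ :=
  2 * (((π.map Prod.fst).rnDeriv μ0 x).toReal - 1)

/-- barycentric W2 velocity. -/
def barW {n : ℕ} (π : Measure (Eucl n × Eucl n)) [IsFiniteMeasure π] (x : Eucl n) : Eucl n :=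
  ∫ y, (y - x) ∂(π.condKernel x)

end

/-- The entropy integrand `s log s - s + 1` of the Kullback–Leibler divergence. -/
noncomputable def entropyFn (s : ℝ) : ℝ := s * Real.log s - s + 1

lemma entropyFn_nonneg {s : ℝ} (hs : 0 ≤ s) : 0 ≤ entropyFn s := by
  have := Real.self_sub_one_le_mul_log hs
  unfold entropyFn
  linarith

lemma measurable_entropyFn : Measurable entropyFn := by
  unfold entropyFn
  fun_prop

lemma entropyFn_le_add_log {s s' : ℝ} (hs : 0 < s) (hs' : 0 < s') :
    entropyFn s' ≤ entropyFn s + (s' - s) * Real.log s' := by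
  have h1 : Real.log (s' / s) ≤ s' / s - 1 := Real.log_le_sub_one_of_pos (by positivity)
  rw [Real.log_div hs'.ne' hs.ne'] at h1
  have h2 : s * (Real.log s' - Real.log s) ≤ s * (s' / s - 1) :=
    mul_le_mul_of_nonneg_left h1 hs.le
  have h3 : s * (s' / s - 1) = s' - s := by field_simp
  unfold entropyFn
  nlinarith

lemma entropyFn_scale_le {u v a : ℝ} (hu : 0 ≤ u) (hv : 0 ≤ v) (ha : 1 / 2 ≤ a) :
    entropyFn (a * u + v) ≤
      entropyFn (u + v) + ((a - 1) * (u * Real.log (u + v)) + 2 * (a - 1) ^ 2 * u) := by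
  rcases (add_nonneg hu hv).eq_or_lt with h0 | hs
  · obtain rfl : u = 0 := by linarith
    obtain rfl : v = 0 := by linarith
    simp
  have hs' : 0 < a * u + v := by nlinarith
  have hconv := entropyFn_le_add_log hs hs'
  suffices h : (a - 1) * (Real.log (a * u + v) - Real.log (u + v)) ≤ 2 * (a - 1) ^ 2 by
    have := mul_le_mul_of_nonneg_left h hu
    nlinarith
  rcases le_total 1 a with h1 | h1
  · have h2 : Real.log ((a * u + v) / (u + v)) ≤ (a * u + v) / (u + v) - 1 :=
      Real.log_le_sub_one_of_pos (by positivity)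
    rw [Real.log_div hs'.ne' hs.ne'] at h2
    have h3 : (a * u + v) / (u + v) - 1 ≤ a - 1 := by
      rw [sub_le_sub_iff_right, div_le_iff₀ hs]
      nlinarith
    nlinarith [mul_le_mul_of_nonneg_left (h2.trans h3) (sub_nonneg.2 h1), sq_nonneg (a - 1)]
  · have h2 : Real.log ((u + v) / (a * u + v)) ≤ (u + v) / (a * u + v) - 1 :=
      Real.log_le_sub_one_of_pos (by positivity)
    rw [Real.log_div hs.ne' hs'.ne'] at h2
    have h3 : (u + v) / (a * u + v) - 1 ≤ 2 * (1 - a) := by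
      rw [sub_le_iff_le_add, div_le_iff₀ hs']
      nlinarith [mul_nonneg (sub_nonneg.2 h1) hu, mul_nonneg (sub_nonneg.2 h1) hv,
        mul_nonneg (mul_nonneg (sub_nonneg.2 h1) hu) (sub_nonneg.2 ha)]
    nlinarith [mul_le_mul_of_nonneg_left (h2.trans h3) (sub_nonneg.2 h1)]

lemma entropyFn_add_le {g u t : ℝ} (hu : 0 ≤ u) (hu1 : u ≤ 1) (ht : 0 < t)
    (hgu : g = 0 ∨ u = 0) :
    entropyFn (g + t * u) ≤ entropyFn g + t * Real.log t * u := by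
  rcases hu.eq_or_lt with rfl | hu
  · simp
  obtain rfl : g = 0 := hgu.resolve_right hu.ne'
  have h1 : Real.log u ≤ 0 := Real.log_nonpos hu.le hu1
  have h2 : t * u * Real.log u ≤ 0 := mul_nonpos_of_nonneg_of_nonpos (by positivity) h1
  have h3 : 0 < t * u := by positivity
  simp only [entropyFn, zero_add, Real.log_mul ht.ne' hu.ne']
  nlinarith

section KL

variable {α : Type*} [MeasurableSpace α] {μ ν ν' ρ ρ' : Measure α}

lemma KLdiv_eq_lintegral (h : ρ ≪ μ) :
    KLdiv ρ μ = ∫⁻ x, ENNReal.ofReal (entropyFn (ρ.rnDeriv μ x).toReal) ∂μ := by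
  rw [KLdiv, if_pos h]
  rfl

lemma absolutelyContinuous_of_KLdiv_ne_top (h : KLdiv ρ μ ≠ ⊤) : ρ ≪ μ := by
  by_contra hn
  exact h (by rw [KLdiv, if_neg hn])

lemma measurable_entropyFn_rnDeriv (ρ μ : Measure α) :
    Measurable fun x => entropyFn (ρ.rnDeriv μ x).toReal :=
  measurable_entropyFn.comp (Measure.measurable_rnDeriv ρ μ).ennreal_toReal

lemma integrable_entropyFn_rnDeriv (h : KLdiv ρ μ ≠ ⊤) :
    Integrable (fun x => entropyFn (ρ.rnDeriv μ x).toReal) μ := by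
  have h' := h
  rw [KLdiv_eq_lintegral (absolutelyContinuous_of_KLdiv_ne_top h)] at h'
  have := integrable_toReal_of_lintegral_ne_top
    (measurable_entropyFn_rnDeriv ρ μ).ennreal_ofReal.aemeasurable h'
  refine this.congr (ae_of_all _ fun x => ?_)
  exact ENNReal.toReal_ofReal (entropyFn_nonneg ENNReal.toReal_nonneg)

lemma KLdiv_eq_ofReal_integral (hac : ρ ≪ μ)
    (h : Integrable (fun x => entropyFn (ρ.rnDeriv μ x).toReal) μ) :
    KLdiv ρ μ = ENNReal.ofReal (∫ x, entropyFn (ρ.rnDeriv μ x).toReal ∂μ) := by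
  rw [KLdiv_eq_lintegral hac, ofReal_integral_eq_lintegral_ofReal h
    (ae_of_all _ fun x => entropyFn_nonneg ENNReal.toReal_nonneg)]

lemma toReal_KLdiv (hac : ρ ≪ μ)
    (h : Integrable (fun x => entropyFn (ρ.rnDeriv μ x).toReal) μ) :
    (KLdiv ρ μ).toReal = ∫ x, entropyFn (ρ.rnDeriv μ x).toReal ∂μ := by
  rw [KLdiv_eq_ofReal_integral hac h, ENNReal.toReal_ofReal
    (integral_nonneg fun x => entropyFn_nonneg ENNReal.toReal_nonneg)]

lemma KLdiv_zero_left (μ : Measure α) [IsFiniteMeasure μ] :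
    KLdiv (0 : Measure α) μ = μ Set.univ := by
  rw [KLdiv_eq_lintegral (Measure.AbsolutelyContinuous.zero μ), ← lintegral_one]
  refine lintegral_congr_ae ?_
  filter_upwards [Measure.rnDeriv_zero μ] with x hx
  simp [hx, entropyFn]

lemma KLdiv_le_add_integral {w : α → ℝ} (hρ : KLdiv ρ μ ≠ ⊤) (hac : ρ' ≪ μ)
    (hw : Integrable w μ)
    (h : ∀ᵐ x ∂μ, entropyFn (ρ'.rnDeriv μ x).toReal ≤
      entropyFn (ρ.rnDeriv μ x).toReal + w x) :
    KLdiv ρ' μ ≠ ⊤ ∧ (KLdiv ρ' μ).toReal ≤ (KLdiv ρ μ).toReal + ∫ x, w x ∂μ := by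
  have hi := integrable_entropyFn_rnDeriv hρ
  have hi' : Integrable (fun x => entropyFn (ρ'.rnDeriv μ x).toReal) μ := by
    refine (hi.add hw).mono (measurable_entropyFn_rnDeriv ρ' μ).aestronglyMeasurable ?_
    filter_upwards [h] with x hx
    have h0 : 0 ≤ entropyFn (ρ'.rnDeriv μ x).toReal := entropyFn_nonneg ENNReal.toReal_nonneg
    rw [Real.norm_of_nonneg h0]
    exact hx.trans (le_abs_self _)
  refine ⟨by rw [KLdiv_eq_ofReal_integral hac hi']; exact ENNReal.ofReal_ne_top, ?_⟩
  rw [toReal_KLdiv hac hi', toReal_KLdiv (absolutelyContinuous_of_KLdiv_ne_top hρ) hi,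
    ← integral_add hi hw]
  exact integral_mono_ae hi' (hi.add hw) h

variable [IsFiniteMeasure μ]

lemma integrable_log_rnDeriv [IsFiniteMeasure ρ] (h : KLdiv ρ μ ≠ ⊤) :
    Integrable (fun x => Real.log (ρ.rnDeriv μ x).toReal) ρ := by
  have hac := absolutelyContinuous_of_KLdiv_ne_top h
  rw [← integrable_rnDeriv_smul_iff hac]
  refine (((integrable_entropyFn_rnDeriv h).add
    (Measure.integrable_toReal_rnDeriv (μ := ρ) (ν := μ))).sub (integrable_const 1)).congr
      (ae_of_all _ fun x => ?_)
  simp only [entropyFn, Pi.add_apply, Pi.sub_apply, smul_eq_mul]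
  ring

lemma toReal_KLdiv_eq_integral_log [IsFiniteMeasure ρ] (h : KLdiv ρ μ ≠ ⊤) :
    (KLdiv ρ μ).toReal = ∫ x, Real.log (ρ.rnDeriv μ x).toReal ∂ρ
      - ρ.real Set.univ + μ.real Set.univ := by
  have hac := absolutelyContinuous_of_KLdiv_ne_top h
  have h1 := (integrable_rnDeriv_smul_iff hac).2 (integrable_log_rnDeriv h)
  have h2 := Measure.integrable_toReal_rnDeriv (μ := ρ) (ν := μ)
  rw [toReal_KLdiv hac (integrable_entropyFn_rnDeriv h), ← integral_rnDeriv_smul hac]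
  simp only [smul_eq_mul] at h1 ⊢
  simp only [entropyFn]
  have h3 : Integrable (fun x => (ρ.rnDeriv μ x).toReal * Real.log (ρ.rnDeriv μ x).toReal
      - (ρ.rnDeriv μ x).toReal) μ := h1.sub h2
  rw [integral_add h3 (integrable_const 1), integral_sub h1 h2,
    Measure.integral_toReal_rnDeriv hac]
  simp

lemma KLdiv_scale_le [IsFiniteMeasure ν] [IsFiniteMeasure ν'] (h : KLdiv (ν + ν') μ ≠ ⊤)
    {a : NNReal} (ha : (1 / 2 : ℝ) ≤ a) :
    KLdiv (a • ν + ν') μ ≠ ⊤ ∧ (KLdiv (a • ν + ν') μ).toReal ≤ (KLdiv (ν + ν') μ).toReal +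
      ((a - 1) * ∫ x, Real.log ((ν + ν').rnDeriv μ x).toReal ∂ν
        + 2 * (a - 1) ^ 2 * ν.real Set.univ) := by
  have hac := absolutelyContinuous_of_KLdiv_ne_top h
  have hν : ν ≪ μ := (Measure.absolutelyContinuous_of_le (Measure.le_add_right le_rfl)).trans hac
  have hν' : ν' ≪ μ := (Measure.absolutelyContinuous_of_le (Measure.le_add_left le_rfl)).trans hac
  have hlog : Integrable (fun x => Real.log ((ν + ν').rnDeriv μ x).toReal) ν :=
    (integrable_log_rnDeriv h).mono_measure (Measure.le_add_right le_rfl)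
  have h1 := (integrable_rnDeriv_smul_iff hν).2 hlog
  have h2 := Measure.integrable_toReal_rnDeriv (μ := ν) (ν := μ)
  have key := KLdiv_le_add_integral (ρ' := a • ν + ν')
    (w := fun x => (a - 1) * ((ν.rnDeriv μ x).toReal •
      Real.log ((ν + ν').rnDeriv μ x).toReal) + 2 * (a - 1) ^ 2 * (ν.rnDeriv μ x).toReal) h
    (Measure.AbsolutelyContinuous.add_left (hν.smul_left a) hν')
    ((h1.const_mul _).add (h2.const_mul _)) ?_
  · rwa [integral_add (h1.const_mul _) (h2.const_mul _), integral_const_mul, integral_const_mul,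
      integral_rnDeriv_smul hν, Measure.integral_toReal_rnDeriv hν] at key
  · filter_upwards [Measure.rnDeriv_add' ν ν' μ, Measure.rnDeriv_add' (a • ν) ν' μ,
      Measure.rnDeriv_smul_left' ν μ a, Measure.rnDeriv_ne_top ν μ, Measure.rnDeriv_ne_top ν' μ]
      with x hx1 hx2 hx3 hx4 hx5
    rw [hx1, hx2, Pi.add_apply, Pi.add_apply, hx3, Pi.smul_apply, ENNReal.smul_def, smul_eq_mul,
      ENNReal.toReal_add (ENNReal.mul_ne_top ENNReal.coe_ne_top hx4) hx5,
      ENNReal.toReal_add hx4 hx5, ENNReal.toReal_mul, ENNReal.coe_toReal]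
    exact entropyFn_scale_le ENNReal.toReal_nonneg ENNReal.toReal_nonneg ha

lemma rnDeriv_eq_zero_or_eq_zero [IsFiniteMeasure ρ] [IsFiniteMeasure ν] (h : ρ ⟂ₘ ν) :
    ∀ᵐ x ∂μ, ρ.rnDeriv μ x = 0 ∨ ν.rnDeriv μ x = 0 := by
  obtain ⟨s, hs, h0, h1⟩ := h
  have e0 := Measure.rnDeriv_restrict ρ μ hs
  have e1 := Measure.rnDeriv_restrict ν μ hs.compl
  rw [Measure.restrict_eq_zero.2 h0] at e0
  rw [Measure.restrict_eq_zero.2 h1] at e1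
  filter_upwards [e0, e1, Measure.rnDeriv_zero μ] with x hx0 hx1 hx
  rw [hx] at hx0 hx1
  by_cases hxs : x ∈ s
  · left; simpa [hxs] using hx0.symm
  · right; simpa [hxs] using hx1.symm

lemma KLdiv_add_singular_le [IsFiniteMeasure ρ] (h : KLdiv ρ μ ≠ ⊤) (hν : ν ≤ μ)
    (hs : ρ ⟂ₘ ν) {t : NNReal} (ht : 0 < t) :
    KLdiv (ρ + t • ν) μ ≠ ⊤ ∧ (KLdiv (ρ + t • ν) μ).toReal ≤ (KLdiv ρ μ).toReal +
      t * Real.log t * ν.real Set.univ := by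
  have : IsFiniteMeasure ν := isFiniteMeasure_of_le μ hν
  have hνac := Measure.absolutelyContinuous_of_le hν
  have h2 := Measure.integrable_toReal_rnDeriv (μ := ν) (ν := μ)
  have key := KLdiv_le_add_integral (ρ' := ρ + t • ν)
    (w := fun x => t * Real.log t * (ν.rnDeriv μ x).toReal) h
    (Measure.AbsolutelyContinuous.add_left (absolutelyContinuous_of_KLdiv_ne_top h)
      (hνac.smul_left t)) (h2.const_mul _) ?_
  · rwa [integral_const_mul, Measure.integral_toReal_rnDeriv hνac] at key
  · filter_upwards [Measure.rnDeriv_add' ρ (t • ν) μ, Measure.rnDeriv_smul_left' ν μ t,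
      Measure.rnDeriv_ne_top ν μ, Measure.rnDeriv_ne_top ρ μ, Measure.rnDeriv_le_one_of_le hν,
      rnDeriv_eq_zero_or_eq_zero (μ := μ) hs] with x hx1 hx2 hx3 hx4 hx5 hx6
    rw [hx1, Pi.add_apply, hx2, Pi.smul_apply, ENNReal.smul_def, smul_eq_mul,
      ENNReal.toReal_add hx4 (ENNReal.mul_ne_top ENNReal.coe_ne_top hx3), ENNReal.toReal_mul,
      ENNReal.coe_toReal]
    refine entropyFn_add_le ENNReal.toReal_nonneg ?_ (NNReal.coe_pos.2 ht) ?_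
    · exact ENNReal.toReal_le_of_le_ofReal zero_le_one (by simpa using hx5)
    · exact hx6.imp (fun h => by simp [h]) (fun h => by simp [h])

end KL

section SqrtMeasure

variable {α : Type*} [MeasurableSpace α]

lemma sqrtMeasure_withDensity (τ : Measure α) [IsFiniteMeasure τ] {p q : α → ℝ≥0∞}
    (hp : Measurable p) (hq : Measurable q) [IsFiniteMeasure (τ.withDensity p)]
    [IsFiniteMeasure (τ.withDensity q)] :
    sqrtMeasure (τ.withDensity p) (τ.withDensity q) =
      τ.withDensity (fun x => (p x * q x) ^ (1 / 2 : ℝ)) := by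
  set ρ := τ.withDensity p
  set σ := τ.withDensity q
  have hsum : ρ + σ = τ.withDensity (p + q) := (withDensity_add_left hp q).symm
  have hρ := Measure.rnDeriv_mul_rnDeriv (κ := τ)
    (Measure.absolutelyContinuous_of_le (Measure.le_add_right (le_refl ρ)) : ρ ≪ ρ + σ)
  have hσ := Measure.rnDeriv_mul_rnDeriv (κ := τ)
    (Measure.absolutelyContinuous_of_le (Measure.le_add_left (le_refl σ)) : σ ≪ ρ + σ)
  have hd : (ρ + σ).rnDeriv τ =ᵐ[τ] p + q := by
    rw [hsum]
    exact Measure.rnDeriv_withDensity τ (hp.add hq)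
  rw [sqrtMeasure]
  conv_lhs => rw [show (ρ + σ).withDensity _ = (τ.withDensity (p + q)).withDensity _ from
    congrArg (Measure.withDensity · _) hsum]
  rw [← withDensity_mul τ (hp.add hq) (by fun_prop)]
  refine withDensity_congr_ae ?_
  filter_upwards [hρ, hσ, hd, Measure.rnDeriv_withDensity τ hp, Measure.rnDeriv_withDensity τ hq]
    with x h1 h2 h3 h4 h5
  rw [Pi.mul_apply, h3] at h1 h2
  rw [← h4, ← h5, ← h1, ← h2, Pi.mul_apply]
  generalize (p + q) x = s
  rw [show ∀ r r' : ℝ≥0∞, r * s * (r' * s) = (s * s) * (r * r') by intros; ring,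
    ENNReal.mul_rpow_of_nonneg (s * s) _ (by norm_num),
    ENNReal.mul_rpow_of_nonneg s s (by norm_num),
    ← ENNReal.rpow_add_of_nonneg _ _ (by norm_num) (by norm_num)]
  norm_num

lemma sqrtMeasure_add_mutuallySingular {π D₀ D₁ : Measure α} [IsFiniteMeasure π]
    [IsFiniteMeasure D₀] [IsFiniteMeasure D₁] {f₀ f₁ : α → ℝ≥0∞}
    (hf₀ : Measurable f₀) (hf₁ : Measurable f₁) [IsFiniteMeasure (π.withDensity f₀)]
    [IsFiniteMeasure (π.withDensity f₁)] (h₀ : π ⟂ₘ D₀) (h₁ : π ⟂ₘ D₁) (h : D₀ ⟂ₘ D₁) :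
    sqrtMeasure (π.withDensity f₀ + D₀) (π.withDensity f₁ + D₁) =
      π.withDensity (fun x => (f₀ x * f₁ x) ^ (1 / 2 : ℝ)) := by
  obtain ⟨E, hE, hπE, hDE⟩ := h₀.add_right h₁
  obtain ⟨hDE₀, hDE₁⟩ : D₀ Eᶜ = 0 ∧ D₁ Eᶜ = 0 := by simpa using hDE
  obtain ⟨G, hG, hG₀, hG₁⟩ := h
  have aeE : ∀ᵐ x ∂π, x ∉ E := measure_eq_zero_iff_ae_notMem.1 hπE
  have aeE₀ : ∀ᵐ x ∂D₀, x ∈ E := by simpa using measure_eq_zero_iff_ae_notMem.1 hDE₀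
  have aeE₁ : ∀ᵐ x ∂D₁, x ∈ E := by simpa using measure_eq_zero_iff_ae_notMem.1 hDE₁
  have aeG₀ : ∀ᵐ x ∂D₀, x ∉ G := measure_eq_zero_iff_ae_notMem.1 hG₀
  have aeG₁ : ∀ᵐ x ∂D₁, x ∈ G := by simpa using measure_eq_zero_iff_ae_notMem.1 hG₁
  have split (φ ψ χ r : α → ℝ≥0∞) (hφ : r =ᵐ[π] φ) (hψ : r =ᵐ[D₀] ψ) (hχ : r =ᵐ[D₁] χ) :
      (π + D₀ + D₁).withDensity r =
        π.withDensity φ + D₀.withDensity ψ + D₁.withDensity χ := by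
    rw [withDensity_add_measure, withDensity_add_measure, withDensity_congr_ae hφ,
      withDensity_congr_ae hψ, withDensity_congr_ae hχ]
  let p : α → ℝ≥0∞ := E.piecewise (G.piecewise 0 1) f₀
  let q : α → ℝ≥0∞ := E.piecewise (G.piecewise 1 0) f₁
  have hp : Measurable p := .piecewise hE (.piecewise hG measurable_const measurable_const) hf₀
  have hq : Measurable q := .piecewise hE (.piecewise hG measurable_const measurable_const) hf₁
  have ep : (π + D₀ + D₁).withDensity p = π.withDensity f₀ + D₀ := by
    rw [split f₀ 1 0 p]
    · simp
    · filter_upwards [aeE] with x hx; simp [p, hx]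
    · filter_upwards [aeE₀, aeG₀] with x hx hx'; simp [p, hx, hx']
    · filter_upwards [aeE₁, aeG₁] with x hx hx'; simp [p, hx, hx']
  have eq : (π + D₀ + D₁).withDensity q = π.withDensity f₁ + D₁ := by
    rw [split f₁ 0 1 q]
    · simp
    · filter_upwards [aeE] with x hx; simp [q, hx]
    · filter_upwards [aeE₀, aeG₀] with x hx hx'; simp [q, hx, hx']
    · filter_upwards [aeE₁, aeG₁] with x hx hx'; simp [q, hx, hx']
  have : IsFiniteMeasure ((π + D₀ + D₁).withDensity p) := by rw [ep]; infer_instance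
  have : IsFiniteMeasure ((π + D₀ + D₁).withDensity q) := by rw [eq]; infer_instance
  rw [← ep, ← eq, sqrtMeasure_withDensity _ hp hq,
    split (fun x => (f₀ x * f₁ x) ^ (1 / 2 : ℝ)) 0 0]
  · simp
  · filter_upwards [aeE] with x hx; simp [p, q, hx]
  · filter_upwards [aeE₀, aeG₀] with x hx hx'; simp [p, q, hx, hx']
  · filter_upwards [aeE₁, aeG₁] with x hx hx'; simp [p, q, hx, hx']

end SqrtMeasure

section Optimality

variable {n : ℕ} {κ : ℝ} {μ0 μ1 : Measure (Eucl n)} {π : Measure (Eucl n × Eucl n)}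

lemma measurable_cHK (κ : ℝ) : Measurable fun p : Eucl n × Eucl n => cHK κ p.1 p.2 := by
  unfold cHK
  refine Measurable.ite (measurableSet_lt (by fun_prop) measurable_const) ?_ measurable_const
  have : Measurable fun p : Eucl n × Eucl n => Real.cos (dist p.1 p.2 / κ) := by fun_prop
  exact (measurable_const.mul (Real.measurable_log.comp this)).ennreal_ofReal

lemma cHK_self (hκ : 0 < κ) (x : Eucl n) : cHK κ x x = 0 := by
  have : 0 < κ * Real.pi / 2 := by positivity
  simp [cHK, this]

lemma HKfun_ne_top_iff (hκ : 0 < κ) : HKfun κ π μ0 μ1 ≠ ⊤ ↔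
    ∫⁻ p, cHK κ p.1 p.2 ∂π ≠ ⊤ ∧ KLdiv (π.map Prod.fst) μ0 ≠ ⊤ ∧
      KLdiv (π.map Prod.snd) μ1 ≠ ⊤ := by
  have : ¬ κ ^ 2 ≤ 0 := not_le.2 (by positivity)
  simp [HKfun, ENNReal.add_eq_top, ENNReal.mul_eq_top, this, not_or, and_assoc]

lemma toReal_HKfun (hκ : 0 < κ) (h : HKfun κ π μ0 μ1 ≠ ⊤) :
    (HKfun κ π μ0 μ1).toReal = (∫⁻ p, cHK κ p.1 p.2 ∂π).toReal
      + κ ^ 2 * (KLdiv (π.map Prod.fst) μ0).toReal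
      + κ ^ 2 * (KLdiv (π.map Prod.snd) μ1).toReal := by
  obtain ⟨hc, h0, h1⟩ := (HKfun_ne_top_iff hκ).1 h
  rw [HKfun, ENNReal.toReal_add, ENNReal.toReal_add, ENNReal.toReal_mul, ENNReal.toReal_mul,
    ENNReal.toReal_ofReal (by positivity)]
  all_goals simp [ENNReal.mul_eq_top, hc, h0, h1]

lemma HKfun_ne_top_of_minimal (hκ : 0 < κ) [IsFiniteMeasure μ0] [IsFiniteMeasure μ1]
    (hmin : ∀ π' : Measure (Eucl n × Eucl n), IsFiniteMeasure π' →
      HKfun κ π μ0 μ1 ≤ HKfun κ π' μ0 μ1) : HKfun κ π μ0 μ1 ≠ ⊤ := by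
  refine ne_top_of_le_ne_top ?_ (hmin 0 inferInstance)
  rw [HKfun_ne_top_iff hκ]
  simp [KLdiv_zero_left]

lemma eq_zero_of_forall_le_quadratic {I C : ℝ}
    (h : ∀ t : ℝ, |t| ≤ 1 / 2 → 0 ≤ t * I + C * t ^ 2) : I = 0 := by
  have hd : HasDerivAt (fun t : ℝ => t * I + C * t ^ 2) I 0 := by
    have h1 := (hasDerivAt_id (0 : ℝ)).mul_const I
    have h2 := ((hasDerivAt_pow 2 (0 : ℝ)).const_mul C)
    exact (h1.add h2).congr_deriv (by simp)
  refine IsLocalMin.hasDerivAt_eq_zero ?_ hd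
  filter_upwards [Metric.ball_mem_nhds (0 : ℝ) (by norm_num : (0 : ℝ) < 1 / 2)] with t ht
  rw [Metric.mem_ball, Real.dist_eq, sub_zero] at ht
  simpa using h t ht.le

/-- The Kullback–Leibler divergence of a marginal, when the plan is rescaled on a set. -/
lemma KLdiv_map_scale_le {α β : Type*} [MeasurableSpace α] [MeasurableSpace β]
    {π : Measure α} [IsFiniteMeasure π] {μ : Measure β} [IsFiniteMeasure μ] {f : α → β}
    (hf : Measurable f) (h : KLdiv (π.map f) μ ≠ ⊤) {A : Set α} (hA : MeasurableSet A)
    {a : NNReal} (ha : (1 / 2 : ℝ) ≤ a) :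
    KLdiv ((a • π.restrict A + π.restrict Aᶜ).map f) μ ≠ ⊤ ∧
      (KLdiv ((a • π.restrict A + π.restrict Aᶜ).map f) μ).toReal ≤ (KLdiv (π.map f) μ).toReal +
      ((a - 1) * ∫ p in A, Real.log ((π.map f).rnDeriv μ (f p)).toReal ∂π
        + 2 * (a - 1) ^ 2 * π.real A) := by
  have e : (π.restrict A).map f + (π.restrict Aᶜ).map f = π.map f := by
    rw [← Measure.map_add _ _ hf, Measure.restrict_add_restrict_compl hA]
  have key := KLdiv_scale_le (μ := μ) (ν := (π.restrict A).map f) (ν' := (π.restrict Aᶜ).map f)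
    (by rwa [e]) ha
  have hm : Measurable fun x => Real.log ((π.map f).rnDeriv μ x).toReal :=
    Real.measurable_log.comp (Measure.measurable_rnDeriv _ μ).ennreal_toReal
  rw [e, integral_map hf.aemeasurable hm.aestronglyMeasurable] at key
  rw [Measure.map_add _ _ hf, Measure.map_smul]
  simpa [Measure.real, Measure.map_apply hf] using key

lemma ae_cHK_add_log_eq_zero (hκ : 0 < κ) [IsFiniteMeasure μ0] [IsFiniteMeasure μ1]
    [IsFiniteMeasure π]
    (hmin : ∀ π' : Measure (Eucl n × Eucl n), IsFiniteMeasure π' →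
      HKfun κ π μ0 μ1 ≤ HKfun κ π' μ0 μ1) :
    (fun p : Eucl n × Eucl n => (cHK κ p.1 p.2).toReal
      + κ ^ 2 * Real.log ((π.map Prod.fst).rnDeriv μ0 p.1).toReal
      + κ ^ 2 * Real.log ((π.map Prod.snd).rnDeriv μ1 p.2).toReal) =ᵐ[π] 0 := by
  have hfin := HKfun_ne_top_of_minimal hκ hmin
  obtain ⟨hc, h0, h1⟩ := (HKfun_ne_top_iff hκ).1 hfin
  have ic : Integrable (fun p : Eucl n × Eucl n => (cHK κ p.1 p.2).toReal) π :=
    integrable_toReal_of_lintegral_ne_top (measurable_cHK κ).aemeasurable hc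
  have i0 : Integrable (fun p : Eucl n × Eucl n =>
      κ ^ 2 * Real.log ((π.map Prod.fst).rnDeriv μ0 p.1).toReal) π :=
    ((integrable_log_rnDeriv h0).comp_measurable measurable_fst).const_mul _
  have i1 : Integrable (fun p : Eucl n × Eucl n =>
      κ ^ 2 * Real.log ((π.map Prod.snd).rnDeriv μ1 p.2).toReal) π :=
    ((integrable_log_rnDeriv h1).comp_measurable measurable_snd).const_mul _
  have i01 : Integrable (fun p : Eucl n × Eucl n => (cHK κ p.1 p.2).toReal
      + κ ^ 2 * Real.log ((π.map Prod.fst).rnDeriv μ0 p.1).toReal) π := ic.add i0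
  refine (i01.add i1).ae_eq_zero_of_forall_setIntegral_eq_zero fun A hA _ => ?_
  refine eq_zero_of_forall_le_quadratic (C := 4 * κ ^ 2 * π.real A) fun t ht => ?_
  obtain ⟨ht1, ht2⟩ := abs_le.1 ht
  let a : NNReal := ⟨1 + t, by linarith⟩
  have ha : (a : ℝ) = 1 + t := rfl
  set π' := a • π.restrict A + π.restrict Aᶜ with hπ'
  obtain ⟨k0, k0'⟩ := KLdiv_map_scale_le measurable_fst h0 hA (a := a) (by linarith)
  obtain ⟨k1, k1'⟩ := KLdiv_map_scale_le measurable_snd h1 hA (a := a) (by linarith)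
  have hcA : ∫⁻ p in A, cHK κ p.1 p.2 ∂π ≠ ⊤ :=
    ne_top_of_le_ne_top hc (setLIntegral_le_lintegral _ _)
  have hcA' : ∫⁻ p in Aᶜ, cHK κ p.1 p.2 ∂π ≠ ⊤ :=
    ne_top_of_le_ne_top hc (setLIntegral_le_lintegral _ _)
  have hcost : ∫⁻ p, cHK κ p.1 p.2 ∂π' =
      a * ∫⁻ p in A, cHK κ p.1 p.2 ∂π + ∫⁻ p in Aᶜ, cHK κ p.1 p.2 ∂π := by
    rw [hπ', lintegral_add_measure, lintegral_smul_measure]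
    rfl
  have hfin' : HKfun κ π' μ0 μ1 ≠ ⊤ := by
    rw [HKfun_ne_top_iff hκ, hcost]
    exact ⟨ENNReal.add_ne_top.2 ⟨ENNReal.mul_ne_top ENNReal.coe_ne_top hcA, hcA'⟩, k0, k1⟩
  have hle := (ENNReal.toReal_le_toReal hfin hfin').2 (hmin π' inferInstance)
  have hcostA : ∫ p in A, (cHK κ p.1 p.2).toReal ∂π
      = (∫⁻ p in A, cHK κ p.1 p.2 ∂π).toReal :=
    integral_toReal (measurable_cHK κ).aemeasurable
      (ae_lt_top (measurable_cHK κ) hcA)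
  rw [toReal_HKfun hκ hfin, toReal_HKfun hκ hfin', hcost, ← lintegral_add_compl _ hA,
    ENNReal.toReal_add hcA hcA', ENNReal.toReal_add
      (ENNReal.mul_ne_top ENNReal.coe_ne_top hcA) hcA', ENNReal.toReal_mul, ENNReal.coe_toReal,
    ← hcostA] at hle
  simp only [Pi.add_apply]
  rw [integral_add i01.integrableOn i1.integrableOn,
    integral_add ic.integrableOn i0.integrableOn, integral_const_mul, integral_const_mul]
  rw [ha] at k0' k1' hle
  have m0 := mul_le_mul_of_nonneg_left k0' (sq_nonneg κ)
  have m1 := mul_le_mul_of_nonneg_left k1' (sq_nonneg κ)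
  linarith

lemma mutuallySingular_singularPart_of_minimal (hκ : 0 < κ) [IsFiniteMeasure μ0]
    [IsFiniteMeasure μ1] [IsFiniteMeasure π]
    (hmin : ∀ π' : Measure (Eucl n × Eucl n), IsFiniteMeasure π' →
      HKfun κ π μ0 μ1 ≤ HKfun κ π' μ0 μ1) :
    μ0.singularPart (π.map Prod.fst) ⟂ₘ μ1.singularPart (π.map Prod.snd) := by
  have hfin := HKfun_ne_top_of_minimal hκ hmin
  obtain ⟨hc, h0, h1⟩ := (HKfun_ne_top_iff hκ).1 hfin
  refine Measure.mutuallySingular_of_disjoint (disjoint_iff.2 ?_)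
  set ν := μ0.singularPart (π.map Prod.fst) ⊓ μ1.singularPart (π.map Prod.snd)
  have hν0 : ν ≤ μ0.singularPart (π.map Prod.fst) := inf_le_left
  have hν1 : ν ≤ μ1.singularPart (π.map Prod.snd) := inf_le_right
  have : IsFiniteMeasure ν := isFiniteMeasure_of_le _ hν0
  let t : NNReal := ⟨Real.exp (-1), (Real.exp_pos _).le⟩
  have ht : 0 < t := Real.exp_pos _
  have hlog : Real.log t = -1 := Real.log_exp _
  have hdiag : Measurable fun x : Eucl n => (x, x) := by fun_prop
  set π' := π + t • ν.map (fun x => (x, x)) with hπ'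
  have e0 : π'.map Prod.fst = π.map Prod.fst + t • ν := by
    rw [hπ', Measure.map_add _ _ measurable_fst, Measure.map_smul,
      Measure.map_map measurable_fst hdiag]
    simp [Function.comp_def]
  have e1 : π'.map Prod.snd = π.map Prod.snd + t • ν := by
    rw [hπ', Measure.map_add _ _ measurable_snd, Measure.map_smul,
      Measure.map_map measurable_snd hdiag]
    simp [Function.comp_def]
  have hcost : ∫⁻ p, cHK κ p.1 p.2 ∂π' = ∫⁻ p, cHK κ p.1 p.2 ∂π := by
    rw [hπ', lintegral_add_measure, lintegral_smul_measure, lintegral_map (measurable_cHK κ) hdiag]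
    simp [cHK_self hκ]
  obtain ⟨k0, k0'⟩ := KLdiv_add_singular_le h0 (hν0.trans (Measure.singularPart_le _ _))
    ((Measure.mutuallySingular_singularPart _ _).symm.mono_ac .rfl
      (Measure.absolutelyContinuous_of_le hν0)) ht
  obtain ⟨k1, k1'⟩ := KLdiv_add_singular_le h1 (hν1.trans (Measure.singularPart_le _ _))
    ((Measure.mutuallySingular_singularPart _ _).symm.mono_ac .rfl
      (Measure.absolutelyContinuous_of_le hν1)) ht
  have hfin' : HKfun κ π' μ0 μ1 ≠ ⊤ := by
    rw [HKfun_ne_top_iff hκ, hcost, e0, e1]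
    exact ⟨hc, k0, k1⟩
  have hle := (ENNReal.toReal_le_toReal hfin hfin').2 (hmin π' inferInstance)
  rw [toReal_HKfun hκ hfin, toReal_HKfun hκ hfin', hcost, e0, e1] at hle
  rw [hlog] at k0' k1'
  have hk : 0 < κ ^ 2 := by positivity
  have m0 := mul_le_mul_of_nonneg_left k0' hk.le
  have m1 := mul_le_mul_of_nonneg_left k1' hk.le
  have hz : 0 ≤ -(κ ^ 2 * (t * ν.real Set.univ)) := by linarith
  have hz' : ν.real Set.univ = 0 := by
    by_contra hne
    have : 0 < ν.real Set.univ := lt_of_le_of_ne measureReal_nonneg (Ne.symm hne)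
    have : 0 < κ ^ 2 * (t * ν.real Set.univ) := mul_pos hk (mul_pos ht this)
    linarith
  rwa [measureReal_eq_zero_iff, Measure.measure_univ_eq_zero] at hz'

/-- The stationarity condition `c_κ(x, y) + κ² log g₀ + κ² log g₁ = 0` in multiplicative form. -/
lemma sqrt_mul_truncCos_eq_one (hκ : 0 < κ) {x y : Eucl n} {g₀ g₁ : ℝ≥0∞}
    (hg₀ : g₀ ≠ 0) (hg₁ : g₁ ≠ 0) (hg₀' : g₀ ≠ ⊤) (hg₁' : g₁ ≠ ⊤) (hc : cHK κ x y ≠ ⊤)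
    (h : (cHK κ x y).toReal + κ ^ 2 * Real.log g₀.toReal + κ ^ 2 * Real.log g₁.toReal = 0) :
    (g₀⁻¹ * g₁⁻¹) ^ (1 / 2 : ℝ) * ENNReal.ofReal (truncCos (dist x y / κ)) = 1 := by
  have hd : dist x y < κ * Real.pi / 2 := by
    by_contra hn
    exact hc (by rw [cHK, if_neg hn])
  have hs0 : 0 ≤ dist x y / κ := by positivity
  have hs1 : dist x y / κ < Real.pi / 2 := by
    rw [div_lt_iff₀ hκ]
    linarith
  have hcos : 0 < Real.cos (dist x y / κ) := Real.cos_pos_of_mem_Ioo ⟨by linarith, hs1⟩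
  have htr : truncCos (dist x y / κ) = Real.cos (dist x y / κ) := by
    rw [truncCos, abs_of_nonneg hs0, min_eq_left hs1.le]
  have hlogc : Real.log (Real.cos (dist x y / κ)) ≤ 0 :=
    Real.log_nonpos hcos.le (Real.cos_le_one _)
  have hp₀ : 0 < g₀.toReal := ENNReal.toReal_pos hg₀ hg₀'
  have hp₁ : 0 < g₁.toReal := ENNReal.toReal_pos hg₁ hg₁'
  rw [cHK, if_pos hd, ENNReal.toReal_ofReal (by nlinarith [sq_nonneg κ])] at h
  have hlog : Real.log (g₀.toReal * g₁.toReal) = Real.log (Real.cos (dist x y / κ) ^ 2) := by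
    rw [Real.log_mul hp₀.ne' hp₁.ne', Real.log_pow]
    have hk : κ ^ 2 ≠ 0 := by positivity
    refine mul_left_cancel₀ hk ?_
    push_cast
    linarith
  have heq : g₀.toReal * g₁.toReal = Real.cos (dist x y / κ) ^ 2 :=
    Real.log_injOn_pos (mul_pos hp₀ hp₁) (pow_pos hcos 2) hlog
  have hE : g₀ * g₁ = ENNReal.ofReal (Real.cos (dist x y / κ)) ^ 2 := by
    rw [← ENNReal.ofReal_pow hcos.le, ← heq, ENNReal.ofReal_mul hp₀.le,
      ENNReal.ofReal_toReal hg₀', ENNReal.ofReal_toReal hg₁']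
  rw [htr, ← ENNReal.mul_inv (Or.inl hg₀) (Or.inl hg₀'), hE, ENNReal.inv_rpow,
    ← ENNReal.rpow_natCast, ← ENNReal.rpow_mul]
  norm_num
  exact ENNReal.inv_mul_cancel (by simpa using hcos) ENNReal.ofReal_ne_top

/-- A measure with prescribed image splits along the Lebesgue decomposition of that image. -/
lemma map_withDensity_rnDeriv_add_singularPart {α β : Type*} [MeasurableSpace α]
    [MeasurableSpace β] {π : Measure α} [IsFiniteMeasure π] {μ : Measure β} [IsFiniteMeasure μ]
    {f : α → β} (hf : Measurable f) {s : β → α} (hs : Measurable s) (hfs : ∀ x, f (s x) = x) :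
    (π.withDensity (fun p => μ.rnDeriv (π.map f) (f p))
      + (μ.singularPart (π.map f)).map s).map f = μ := by
  have hm := Measure.measurable_rnDeriv μ (π.map f)
  have e : (π.withDensity fun p => μ.rnDeriv (π.map f) (f p)).map f =
      (π.map f).withDensity (μ.rnDeriv (π.map f)) := by
    ext A hA
    rw [Measure.map_apply hf hA, withDensity_apply _ (hf hA), withDensity_apply _ hA,
      setLIntegral_map hA hm hf]
  rw [Measure.map_add _ _ hf, e, Measure.map_map hf hs, show f ∘ s = id from funext hfs,
    Measure.map_id, Measure.rnDeriv_add_singularPart]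

lemma mutuallySingular_of_map {α β : Type*} [MeasurableSpace α]
    [MeasurableSpace β] {π D : Measure α} {f : α → β} (hf : Measurable f)
    (h : π.map f ⟂ₘ D.map f) : π ⟂ₘ D := by
  obtain ⟨s, hs, h0, h1⟩ := h
  refine ⟨f ⁻¹' s, hf hs, ?_, ?_⟩
  · rwa [Measure.map_apply hf hs] at h0
  · rwa [Measure.map_apply hf hs.compl] at h1

lemma toReal_HKfun_of_minimal (hκ : 0 < κ) [IsFiniteMeasure μ0] [IsFiniteMeasure μ1]
    [IsFiniteMeasure π]
    (hmin : ∀ π' : Measure (Eucl n × Eucl n), IsFiniteMeasure π' →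
      HKfun κ π μ0 μ1 ≤ HKfun κ π' μ0 μ1) :
    (HKfun κ π μ0 μ1).toReal = κ ^ 2 * (μ0.real Set.univ + μ1.real Set.univ)
      - 2 * κ ^ 2 * π.real Set.univ := by
  have hfin := HKfun_ne_top_of_minimal hκ hmin
  obtain ⟨hc, h0, h1⟩ := (HKfun_ne_top_iff hκ).1 hfin
  have ic : Integrable (fun p : Eucl n × Eucl n => (cHK κ p.1 p.2).toReal) π :=
    integrable_toReal_of_lintegral_ne_top (measurable_cHK κ).aemeasurable hc
  have j0 := integrable_log_rnDeriv h0
  have j1 := integrable_log_rnDeriv h1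
  have i0 : Integrable (fun p : Eucl n × Eucl n =>
      κ ^ 2 * Real.log ((π.map Prod.fst).rnDeriv μ0 p.1).toReal) π :=
    (j0.comp_measurable measurable_fst).const_mul _
  have i1 : Integrable (fun p : Eucl n × Eucl n =>
      κ ^ 2 * Real.log ((π.map Prod.snd).rnDeriv μ1 p.2).toReal) π :=
    (j1.comp_measurable measurable_snd).const_mul _
  have hz := integral_congr_ae (ae_cHK_add_log_eq_zero hκ hmin)
  have i01 : Integrable (fun p : Eucl n × Eucl n => (cHK κ p.1 p.2).toReal
      + κ ^ 2 * Real.log ((π.map Prod.fst).rnDeriv μ0 p.1).toReal) π := ic.add i0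
  rw [integral_add i01 i1, integral_add ic i0, integral_const_mul, integral_const_mul,
    integral_toReal (measurable_cHK κ).aemeasurable (ae_lt_top (measurable_cHK κ) hc),
    ← integral_map measurable_fst.aemeasurable j0.aestronglyMeasurable,
    ← integral_map measurable_snd.aemeasurable j1.aestronglyMeasurable] at hz
  simp only [Pi.zero_apply, integral_zero] at hz
  rw [toReal_HKfun hκ hfin, toReal_KLdiv_eq_integral_log h0, toReal_KLdiv_eq_integral_log h1]
  have r0 : (π.map Prod.fst).real Set.univ = π.real Set.univ := by
    simp [Measure.real, Measure.map_apply measurable_fst]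
  have r1 : (π.map Prod.snd).real Set.univ = π.real Set.univ := by
    simp [Measure.real, Measure.map_apply measurable_snd]
  rw [r0, r1]
  linarith

lemma lintegral_truncCos_sqrtMeasure_of_minimal (hκ : 0 < κ) [IsFiniteMeasure μ0]
    [IsFiniteMeasure μ1] [IsFiniteMeasure π]
    (hmin : ∀ π' : Measure (Eucl n × Eucl n), IsFiniteMeasure π' →
      HKfun κ π μ0 μ1 ≤ HKfun κ π' μ0 μ1) :
    ∫⁻ p, ENNReal.ofReal (truncCos (dist p.1 p.2 / κ)) ∂(sqrtMeasure
      (π.withDensity (fun p => μ0.rnDeriv (π.map Prod.fst) p.1)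
        + (μ0.singularPart (π.map Prod.fst)).map (fun x => (x, x)))
      (π.withDensity (fun p => μ1.rnDeriv (π.map Prod.snd) p.2)
        + (μ1.singularPart (π.map Prod.snd)).map (fun x => (x, x)))) = π Set.univ := by
  have hfin := HKfun_ne_top_of_minimal hκ hmin
  obtain ⟨hc, h0, h1⟩ := (HKfun_ne_top_iff hκ).1 hfin
  have hac0 := absolutelyContinuous_of_KLdiv_ne_top h0
  have hac1 := absolutelyContinuous_of_KLdiv_ne_top h1
  have hdiag : Measurable fun x : Eucl n => (x, x) := by fun_prop
  have hm0 : Measurable fun p : Eucl n × Eucl n => μ0.rnDeriv (π.map Prod.fst) p.1 :=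
    (Measure.measurable_rnDeriv _ _).comp measurable_fst
  have hm1 : Measurable fun p : Eucl n × Eucl n => μ1.rnDeriv (π.map Prod.snd) p.2 :=
    (Measure.measurable_rnDeriv _ _).comp measurable_snd
  have : IsFiniteMeasure (π.withDensity fun p => μ0.rnDeriv (π.map Prod.fst) p.1) :=
    isFiniteMeasure_withDensity (by
      rw [← lintegral_map (Measure.measurable_rnDeriv _ _) measurable_fst]
      exact (Measure.lintegral_rnDeriv_lt_top _ _).ne)
  have : IsFiniteMeasure (π.withDensity fun p => μ1.rnDeriv (π.map Prod.snd) p.2) :=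
    isFiniteMeasure_withDensity (by
      rw [← lintegral_map (Measure.measurable_rnDeriv _ _) measurable_snd]
      exact (Measure.lintegral_rnDeriv_lt_top _ _).ne)
  rw [sqrtMeasure_add_mutuallySingular hm0 hm1, lintegral_withDensity_eq_lintegral_mul _
    (by fun_prop) (by unfold truncCos; fun_prop), ← lintegral_one]
  · refine lintegral_congr_ae ?_
    filter_upwards [ae_cHK_add_log_eq_zero hκ hmin, ae_lt_top (measurable_cHK κ) hc,
      ae_of_ae_map measurable_fst.aemeasurable (Measure.inv_rnDeriv hac0),
      ae_of_ae_map measurable_snd.aemeasurable (Measure.inv_rnDeriv hac1),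
      ae_of_ae_map measurable_fst.aemeasurable (Measure.rnDeriv_pos hac0),
      ae_of_ae_map measurable_snd.aemeasurable (Measure.rnDeriv_pos hac1),
      ae_of_ae_map measurable_fst.aemeasurable (hac0.ae_le (Measure.rnDeriv_ne_top (π.map Prod.fst) μ0)),
      ae_of_ae_map measurable_snd.aemeasurable (hac1.ae_le (Measure.rnDeriv_ne_top (π.map Prod.snd) μ1))]
      with p hp hpc hf0 hf1 hg0 hg1 hg0' hg1'
    simp only [Pi.mul_apply]
    rw [← hf0, ← hf1]
    exact sqrt_mul_truncCos_eq_one hκ hg0.ne' hg1.ne' hg0' hg1' hpc.ne hp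
  · refine mutuallySingular_of_map measurable_fst ?_
    rw [Measure.map_map measurable_fst hdiag]
    simpa [Function.comp_def] using (Measure.mutuallySingular_singularPart μ0 _).symm
  · refine mutuallySingular_of_map measurable_snd ?_
    rw [Measure.map_map measurable_snd hdiag]
    simpa [Function.comp_def] using (Measure.mutuallySingular_singularPart μ1 _).symm
  · refine mutuallySingular_of_map measurable_fst ?_
    rw [Measure.map_map measurable_fst hdiag, Measure.map_map measurable_fst hdiag]
    simpa [Function.comp_def] using mutuallySingular_singularPart_of_minimal hκ hmin

end Optimality

/-- optimal semi-couplings built from an optimal soft-marginal plan. -/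
theorem hk_semicouplings_from_optimal_plan
    {n : ℕ} (hn : 1 ≤ n) (κ : ℝ) (hκ : 0 < κ)
    (μ0 μ1 : Measure (Eucl n)) [IsFiniteMeasure μ0] [IsFiniteMeasure μ1]
    (hμ0K : ∃ K : Set (Eucl n), IsCompact K ∧ μ0 Kᶜ = 0)
    (hμ1K : ∃ K : Set (Eucl n), IsCompact K ∧ μ1 Kᶜ = 0)
    -- `π` is a minimizer of `E_κ(·|μ0,μ1)`
    (π : Measure (Eucl n × Eucl n)) [IsFiniteMeasure π]
    (hπmin : ∀ π' : Measure (Eucl n × Eucl n), IsFiniteMeasure π' →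
      HKfun κ π μ0 μ1 ≤ HKfun κ π' μ0 μ1)
    -- the semi-couplings `γ0`, `γ1`
    (γ0 γ1 : Measure (Eucl n × Eucl n))
    (hγ0 : γ0 = π.withDensity (fun p => μ0.rnDeriv (π.map Prod.fst) p.1)
      + (μ0.singularPart (π.map Prod.fst)).map (fun x => (x, x)))
    (hγ1 : γ1 = π.withDensity (fun p => μ1.rnDeriv (π.map Prod.snd) p.2)
      + (μ1.singularPart (π.map Prod.snd)).map (fun x => (x, x))) :
    γ0.map Prod.fst = μ0 ∧ γ1.map Prod.snd = μ1 ∧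
    ENNReal.ofReal (κ ^ 2) * (γ0 Set.univ + γ1 Set.univ)
      = HK2 κ μ0 μ1 + ENNReal.ofReal (κ ^ 2)
        * (2 * ∫⁻ p, ENNReal.ofReal (truncCos (dist p.1 p.2 / κ)) ∂(sqrtMeasure γ0 γ1)) := by
  have hdiag : Measurable fun x : Eucl n => (x, x) := by fun_prop
  have m0 : γ0.map Prod.fst = μ0 := by
    rw [hγ0]
    exact map_withDensity_rnDeriv_add_singularPart measurable_fst hdiag fun _ => rfl
  have m1 : γ1.map Prod.snd = μ1 := by
    rw [hγ1]
    exact map_withDensity_rnDeriv_add_singularPart measurable_snd hdiag fun _ => rfl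
  refine ⟨m0, m1, ?_⟩
  have u0 : γ0 Set.univ = μ0 Set.univ := by
    rw [← m0, Measure.map_apply measurable_fst .univ, Set.preimage_univ]
  have u1 : γ1 Set.univ = μ1 Set.univ := by
    rw [← m1, Measure.map_apply measurable_snd .univ, Set.preimage_univ]
  have hHK : HK2 κ μ0 μ1 = HKfun κ π μ0 μ1 :=
    le_antisymm (iInf₂_le_of_le π ‹IsFiniteMeasure π› le_rfl) (le_iInf₂ hπmin)
  have hfin := HKfun_ne_top_of_minimal hκ hπmin
  have hE := toReal_HKfun_of_minimal hκ hπmin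
  rw [u0, u1, hHK, hγ0, hγ1, lintegral_truncCos_sqrtMeasure_of_minimal hκ hπmin]
  have hr : ENNReal.ofReal (κ ^ 2) * (2 * π Set.univ) ≠ ⊤ := by finiteness
  rw [← ENNReal.toReal_eq_toReal_iff' (by finiteness) (ENNReal.add_ne_top.2 ⟨hfin, hr⟩),
    ENNReal.toReal_add hfin hr, hE, ENNReal.toReal_mul, ENNReal.toReal_mul, ENNReal.toReal_mul,
    ENNReal.toReal_add (by finiteness) (by finiteness), ENNReal.toReal_ofReal (sq_nonneg κ)]
  simp only [Measure.real, ENNReal.toReal_ofNat]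
  ring
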